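/- Let 1 < α ≤ 2, β₁ > 1/(α−1) and β₂ > 1/(α−1), and let (m_n) be a sequence of positive integers such that m_n^{−β₂}/n^{−β₁} → c for some c ∈ (0,∞) as n → ∞. Then lim_{n→∞} ρ(n,−m_n)/(n^{−β₁(α−1)} m_n^{−β₂}) = (1/c) · Σ_{i=0}^∞ Σ_{j=0}^∞ V(w_{(∞,j)} (1+j)^{−β₂}, c · w_{(i,∞)} (1+i)^{−β₁}). -/

import Mathlib

open Filter MeasureTheory Real Set

/-- The kernel `V(x,y) = xy/(x^2+y^2)^{(2-α)/2}` with `V(0,0)=0`. -/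
noncomputable def V (α : ℝ) : ℝ → ℝ → ℝ := fun x y =>
  if x = 0 ∧ y = 0 then 0 else x * y / (x ^ 2 + y ^ 2) ^ ((2 - α) / 2)


lemma V_hom (α t x y : ℝ) (ht : 0 < t) : V α (t * x) (t * y) = t ^ α * V α x y := by
  unfold V
  by_cases h : x = 0 ∧ y = 0
  · simp [h.1, h.2]
  · have h' : ¬ (t * x = 0 ∧ t * y = 0) := by simpa [ht.ne'] using h
    rw [if_neg h, if_neg h']
    have hs : 0 < x ^ 2 + y ^ 2 := by
      rcases not_and_or.mp h with h | h <;> positivity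
    have e : (t * x) ^ 2 + (t * y) ^ 2 = t ^ (2:ℝ) * (x ^ 2 + y ^ 2) := by
      rw [Real.rpow_two]; ring
    rw [e, Real.mul_rpow (by positivity) hs.le, ← Real.rpow_mul ht.le]
    have e2 : t * x * (t * y) = t ^ α * t ^ (2 * ((2 - α) / 2)) * (x * y) := by
      rw [← Real.rpow_add ht]
      have : α + 2 * ((2 - α) / 2) = (2:ℝ) := by ring
      rw [this, Real.rpow_two]; ring
    rw [e2]
    have h1 : 0 < t ^ (2 * ((2 - α) / 2)) := by positivity
    have h2 : 0 < (x ^ 2 + y ^ 2) ^ ((2 - α) / 2) := by positivity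
    field_simp

lemma V_bound (α x y : ℝ) (hα : 1 < α) (hα2 : α ≤ 2) : |V α x y| ≤ (|x| * |y|) ^ (α / 2) := by
  by_cases h : x = 0 ∨ y = 0
  · have : V α x y = 0 := by
      unfold V
      rcases h with h | h <;> simp [h]
    rw [this, abs_zero]; positivity
  · push Not at h
    have hx : 0 < |x| := abs_pos.mpr h.1
    have hy : 0 < |y| := abs_pos.mpr h.2
    unfold V
    rw [if_neg (by tauto)]
    have hs : |x| * |y| ≤ x ^ 2 + y ^ 2 := by
      rw [← sq_abs x, ← sq_abs y]; nlinarith [sq_nonneg (|x| - |y|)]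
    have hp : 0 < |x| * |y| := by positivity
    have hs0 := hp.trans_le hs
    rw [abs_div, abs_mul, abs_of_pos (Real.rpow_pos_of_pos hs0 _), div_le_iff₀ (by positivity)]
    calc |x| * |y| = (|x| * |y|) ^ (α / 2) * (|x| * |y|) ^ ((2 - α) / 2) := by
          rw [← Real.rpow_add hp]
          have : α / 2 + (2 - α) / 2 = 1 := by ring
          rw [this, Real.rpow_one]
      _ ≤ _ := by
          gcongr

lemma V_cont {ι : Type*} {l : Filter ι} (α : ℝ) {f g : ι → ℝ} {a b : ℝ} (ha : 0 < a) (hb : 0 < b)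
    (hf : Tendsto f l (nhds a)) (hg : Tendsto g l (nhds b)) :
    Tendsto (fun n => V α (f n) (g n)) l (nhds (V α a b)) := by
  have h1 : V α a b = a * b / (a ^ 2 + b ^ 2) ^ ((2 - α) / 2) := by
    unfold V; rw [if_neg (by intro h; exact ha.ne' h.1)]
  have h2 : (fun n => f n * g n / (f n ^ 2 + g n ^ 2) ^ ((2 - α) / 2)) = fun n => V α (f n) (g n) := by
    funext n
    unfold V
    split_ifs with h
    · simp [h.1]
    · rfl
  rw [h1, ← h2]
  have hp : 0 < a ^ 2 + b ^ 2 := by positivity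
  exact (hf.mul hg).div (((hf.pow 2).add (hg.pow 2)).rpow_const (Or.inl hp.ne'))
    (Real.rpow_pos_of_pos hp _).ne'

lemma seq_bdd {f : ℕ → ℝ} {a : ℝ} (h : Tendsto f atTop (nhds a)) : ∃ K, ∀ n, |f n| ≤ K := by
  obtain ⟨K, hK⟩ := h.abs.bddAbove_range
  exact ⟨K, fun n => hK ⟨n, rfl⟩⟩

lemma w_bdd (w : ℕ → ℕ → ℝ)
    (hA1 : Tendsto (fun p : ℕ × ℕ => w p.1 p.2) (atTop ×ˢ atTop) (nhds 1))
    (winf : ℕ → ℝ) (hA2 : ∀ i, Tendsto (fun j => w i j) atTop (nhds (winf i)))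
    (wco : ℕ → ℝ) (hA3 : ∀ j, Tendsto (fun i => w i j) atTop (nhds (wco j))) :
    ∃ K, 0 < K ∧ ∀ i j, |w i j| ≤ K := by
  choose R hR using fun i => seq_bdd (hA2 i)
  choose S hS using fun j => seq_bdd (hA3 j)
  have h1 := hA1.abs.eventually (gt_mem_nhds (show |(1:ℝ)| < 2 by norm_num))
  rw [prod_atTop_atTop_eq, eventually_atTop] at h1
  obtain ⟨⟨a, b⟩, hab⟩ := h1
  refine ⟨2 + ∑ i ∈ Finset.range a, |R i| + ∑ j ∈ Finset.range b, |S j|, ?_, ?_⟩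
  · positivity
  · intro i j
    have p1 : 0 ≤ ∑ i ∈ Finset.range a, |R i| := by positivity
    have p2 : 0 ≤ ∑ j ∈ Finset.range b, |S j| := by positivity
    by_cases hi : i < a
    · have := Finset.single_le_sum (f := fun i => |R i|) (fun i _ => abs_nonneg _)
        (Finset.mem_range.mpr hi)
      have h2 := hR i j
      have h3 := le_abs_self (R i)
      linarith
    · by_cases hj : j < b
      · have := Finset.single_le_sum (f := fun i => |S i|) (fun i _ => abs_nonneg _)
          (Finset.mem_range.mpr hj)
        have h2 := hS j i
        have h3 := le_abs_self (S j)
        linarith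
      · have := hab (i, j) ⟨not_lt.mp hi, not_lt.mp hj⟩
        simp only at this
        linarith

lemma shift_tendsto (β : ℝ) (i : ℕ) :
    Tendsto (fun n : ℕ => ((1 + ((i + n : ℕ) : ℝ)) / n) ^ (-β)) atTop (nhds 1) := by
  have h : Tendsto (fun n : ℕ => (1 + (i:ℝ)) / n + 1) atTop (nhds (0 + 1)) :=
    (tendsto_const_div_atTop_nhds_zero_nat _).add_const 1
  have h2 : Tendsto (fun n : ℕ => ((1 + ((i + n : ℕ) : ℝ)) / n)) atTop (nhds 1) := by
    rw [zero_add] at h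
    refine h.congr' ?_
    filter_upwards [eventually_ge_atTop 1] with n hn
    have : (0:ℝ) < n := by exact_mod_cast hn
    push_cast
    field_simp
    ring
  have h3 := h2.rpow_const (p := -β) (Or.inl one_ne_zero)
  simpa using h3

lemma shift_le (β : ℝ) (hβ : 0 < β) (i n : ℕ) (hn : 1 ≤ n) :
    |((1 + ((i + n : ℕ) : ℝ)) / n) ^ (-β)| ≤ 1 := by
  have : (0:ℝ) < n := by exact_mod_cast hn
  rw [abs_of_nonneg (by positivity)]
  apply Real.rpow_le_one_of_one_le_of_nonpos
  · rw [le_div_iff₀ this]; push_cast; have : (0:ℝ) ≤ i := by positivity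
    linarith
  · linarith

lemma shift_eq (β : ℝ) (i n : ℕ) (hn : 1 ≤ n) :
    (1 + ((i + n : ℕ) : ℝ)) ^ (-β) = (n:ℝ) ^ (-β) * ((1 + ((i + n : ℕ) : ℝ)) / n) ^ (-β) := by
  have : (0:ℝ) < n := by exact_mod_cast hn
  rw [← Real.mul_rpow (by positivity) (by positivity)]
  congr 1
  field_simp

lemma summ_aux (β γ : ℝ) (h : 1 < β * γ) :
    Summable (fun i : ℕ => ((1 + (i:ℝ)) ^ (-β)) ^ γ) := by
  have h1 : Summable (fun i : ℕ => (i:ℝ) ^ (-(β * γ))) := Real.summable_nat_rpow.mpr (by linarith)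
  have h2 := (summable_nat_add_iff 1).mpr h1
  refine h2.congr fun i => ?_
  rw [← Real.rpow_mul (by positivity)]
  push_cast
  rw [add_comm]
  congr 1
  ring

theorem stmt10 (α β₁ β₂ : ℝ)
    (hα : 1 < α) (hα2 : α ≤ 2)
    (hβ₁ : 1 / (α - 1) < β₁) (hβ₂ : 1 / (α - 1) < β₂)
    (w : ℕ → ℕ → ℝ) (hw : ∀ i j, w i j ≠ 0)
    (hA1 : Tendsto (fun p : ℕ × ℕ => w p.1 p.2) (atTop ×ˢ atTop) (nhds 1))
    (winf : ℕ → ℝ)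
    (hA2 : ∀ i, Tendsto (fun j => w i j) atTop (nhds (winf i)) ∧ 0 < winf i)
    (wco : ℕ → ℝ)
    (hA3 : ∀ j, Tendsto (fun i => w i j) atTop (nhds (wco j)) ∧ 0 < wco j)
    (c : ℕ → ℕ → ℝ)
    (hc : ∀ i j, c i j = w i j * (1 + (i : ℝ)) ^ (-β₁) * (1 + (j : ℝ)) ^ (-β₂))
    (ρ : ℕ → ℕ → ℝ)
    (hsum : ∀ n m : ℕ, 1 ≤ n → 1 ≤ m →
      Summable (fun q : ℕ × ℕ => V α (c (q.1 + n) q.2) (c q.1 (q.2 + m))))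
    (hρ : ∀ n m : ℕ, 1 ≤ n → 1 ≤ m →
      ρ n m = ∑' i : ℕ, ∑' j : ℕ, V α (c (i + n) j) (c i (j + m)))
    (m : ℕ → ℕ) (hm : ∀ n, 1 ≤ m n) (C : ℝ) (hC : 0 < C)
    (hratio : Tendsto (fun n : ℕ => (m n : ℝ) ^ (-β₂) / (n : ℝ) ^ (-β₁))
      atTop (nhds C))
    :
    Tendsto (fun n : ℕ => ρ n (m n) / ((n : ℝ) ^ (-(β₁ * (α - 1))) * (m n : ℝ) ^ (-β₂)))
      atTop
      (nhds ((1 / C) * ∑' i : ℕ, ∑' j : ℕ,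
        V α (wco j * (1 + (j : ℝ)) ^ (-β₂)) (C * winf i * (1 + (i : ℝ)) ^ (-β₁)))) := by
  have hα1 : 0 < α - 1 := by linarith
  have hb1 : 0 < β₁ := lt_trans (by positivity) hβ₁
  have hb2 : 0 < β₂ := lt_trans (by positivity) hβ₂
  have hs1 : 1 < β₁ * (α / 2) := by
    rw [div_lt_iff₀ hα1] at hβ₁; nlinarith
  have hs2 : 1 < β₂ * (α / 2) := by
    rw [div_lt_iff₀ hα1] at hβ₂; nlinarith
  obtain ⟨K, hK, hwK⟩ := w_bdd w hA1 winf (fun i => (hA2 i).1) wco (fun j => (hA3 j).1)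
  have hwinf : ∀ i, |winf i| ≤ K := fun i =>
    le_of_tendsto (hA2 i).1.abs (Eventually.of_forall fun j => hwK i j)
  have hwco : ∀ j, |wco j| ≤ K := fun j =>
    le_of_tendsto (hA3 j).1.abs (Eventually.of_forall fun i => hwK i j)
  set r : ℕ → ℝ := fun n => (m n : ℝ) ^ (-β₂) / (n : ℝ) ^ (-β₁) with hr
  -- m tends to infinity
  have hmtop : Tendsto m atTop atTop := by
    have h0 : Tendsto (fun n : ℕ => (n:ℝ) ^ (-β₁)) atTop (nhds 0) :=
      (tendsto_rpow_neg_atTop hb1).comp tendsto_natCast_atTop_atTop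
    have h1 : Tendsto (fun n : ℕ => (m n:ℝ) ^ (-β₂)) atTop (nhds 0) := by
      have h2 := hratio.mul h0
      rw [mul_zero] at h2
      refine h2.congr' ?_
      filter_upwards [eventually_ge_atTop 1] with n hn
      have : (0:ℝ) < n := by exact_mod_cast hn
      have : (0:ℝ) < (n:ℝ) ^ (-β₁) := by positivity
      simp only [hr]
      field_simp
    rw [tendsto_atTop]
    intro b
    have hbp : (0:ℝ) < (1 + b : ℝ) ^ (-β₂) := by positivity
    filter_upwards [h1.eventually (gt_mem_nhds hbp)] with n hn
    by_contra hlt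
    push Not at hlt
    have hm0 : (0:ℝ) < m n := by exact_mod_cast hm n
    have : (m n : ℝ) ≤ 1 + b := by
      have : (m n : ℝ) < b := by exact_mod_cast hlt
      linarith
    have := Real.rpow_le_rpow_of_nonpos hm0 this (z := -β₂) (by linarith)
    linarith
  let X : ℕ → ℕ × ℕ → ℝ := fun n q =>
    w (q.1 + n) q.2 * ((1 + ((q.1 + n : ℕ) : ℝ)) / n) ^ (-β₁) * (1 + (q.2:ℝ)) ^ (-β₂)
  let Y : ℕ → ℕ × ℕ → ℝ := fun n q =>
    r n * (w q.1 (q.2 + m n) * ((1 + ((q.2 + m n : ℕ) : ℝ)) / m n) ^ (-β₂)) * (1 + (q.1:ℝ)) ^ (-β₁)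
  let A : ℕ × ℕ → ℝ := fun q => wco q.2 * (1 + (q.2:ℝ)) ^ (-β₂)
  let B : ℕ × ℕ → ℝ := fun q => C * winf q.1 * (1 + (q.1:ℝ)) ^ (-β₁)
  let bd : ℕ × ℕ → ℝ := fun q => (K * ((C + 1) * K)) ^ (α / 2) *
    (((1 + (q.1:ℝ)) ^ (-β₁)) ^ (α / 2) * ((1 + (q.2:ℝ)) ^ (-β₂)) ^ (α / 2))
  have hbd : Summable bd := by
    apply Summable.mul_left
    exact (summ_aux β₁ (α / 2) hs1).mul_of_nonneg (summ_aux β₂ (α / 2) hs2)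
      (fun i => by positivity) (fun i => by positivity)
  have key : ∀ (q : ℕ × ℕ) (x y : ℝ), |x| ≤ K → |y| ≤ (C + 1) * K →
      ‖V α (x * (1 + (q.2:ℝ)) ^ (-β₂)) (y * (1 + (q.1:ℝ)) ^ (-β₁))‖ ≤ bd q := by
    intro q x y hx hy
    rw [Real.norm_eq_abs]
    refine (V_bound α _ _ hα hα2).trans ?_
    have p1 : 0 < (1 + (q.1:ℝ)) ^ (-β₁) := by positivity
    have p2 : 0 < (1 + (q.2:ℝ)) ^ (-β₂) := by positivity
    have hC1 : 0 < C + 1 := by linarith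
    simp only [bd]
    rw [← Real.mul_rpow p1.le p2.le, ← Real.mul_rpow (by positivity) (by positivity),
      abs_mul, abs_mul, abs_of_pos p1, abs_of_pos p2]
    apply Real.rpow_le_rpow (by positivity) _ (by linarith)
    calc _ = (|x| * |y|) * ((1 + (q.1:ℝ)) ^ (-β₁) * (1 + (q.2:ℝ)) ^ (-β₂)) := by ring
      _ ≤ _ := by gcongr
  have hlim : Tendsto (fun n => ∑' q, V α (X n q) (Y n q)) atTop (nhds (∑' q, V α (A q) (B q))) := by
    apply tendsto_tsum_of_dominated_convergence hbd
    · intro q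
      apply V_cont
      · have := (hA3 q.2).2
        simp only [A]; positivity
      · have := (hA2 q.1).2
        simp only [B]; positivity
      · have h1 : Tendsto (fun n => w (q.1 + n) q.2) atTop (nhds (wco q.2)) :=
          (hA3 q.2).1.comp (tendsto_atTop_mono (fun n => Nat.le_add_left n q.1) tendsto_id)
        have h2 := (h1.mul (shift_tendsto β₁ q.1)).mul_const ((1 + (q.2:ℝ)) ^ (-β₂))
        rw [mul_one] at h2
        exact h2
      · have h1 : Tendsto (fun n => w q.1 (q.2 + m n)) atTop (nhds (winf q.1)) :=
          (hA2 q.1).1.comp (tendsto_atTop_mono (fun n => Nat.le_add_left (m n) q.2) hmtop)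
        have h2 := (hratio.mul (h1.mul ((shift_tendsto β₂ q.2).comp hmtop))).mul_const
          ((1 + (q.1:ℝ)) ^ (-β₁))
        rw [mul_one] at h2
        exact h2
    · filter_upwards [eventually_ge_atTop 1,
        hratio.abs.eventually (gt_mem_nhds (show |C| < C + 1 by rw [abs_of_pos hC]; linarith))]
        with n hn hrn q
      apply key
      · rw [abs_mul]
        calc _ ≤ K * 1 := by
              gcongr
              · exact hwK _ _
              · exact shift_le β₁ hb1 _ _ hn
          _ = K := mul_one K
      · rw [abs_mul, abs_mul]
        calc _ ≤ (C + 1) * (K * 1) := by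
              gcongr
              · exact hwK _ _
              · exact shift_le β₂ hb2 _ _ (hm n)
          _ = _ := by ring
  have hABs : Summable (fun q => V α (A q) (B q)) := by
    refine Summable.of_norm_bounded hbd fun q => key q _ _ (hwco _) ?_
    rw [abs_mul, abs_of_pos hC]
    have := hwinf q.1
    gcongr
    linarith
  have hAB : ∑' q, V α (A q) (B q) = ∑' i : ℕ, ∑' j : ℕ,
        V α (wco j * (1 + (j : ℝ)) ^ (-β₂)) (C * winf i * (1 + (i : ℝ)) ^ (-β₁)) :=
    hABs.tsum_prod
  rw [← hAB, one_div]
  refine ((hratio.inv₀ hC.ne').mul hlim).congr' ?_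
  filter_upwards [eventually_ge_atTop 1] with n hn
  have hn0 : (0:ℝ) < n := by exact_mod_cast hn
  have hm0 : (0:ℝ) < m n := by exact_mod_cast hm n
  have t0 : (0:ℝ) < (n:ℝ) ^ (-β₁) := by positivity
  have s0 : (0:ℝ) < (m n:ℝ) ^ (-β₂) := by positivity
  have hρ' : ρ n (m n) = ((n:ℝ) ^ (-β₁)) ^ α * ∑' q, V α (X n q) (Y n q) := by
    rw [hρ n (m n) hn (hm n), ← (hsum n (m n) hn (hm n)).tsum_prod, ← tsum_mul_left]
    congr 1
    funext q
    rw [← V_hom α _ _ _ t0, hc, hc, shift_eq β₁ q.1 n hn, shift_eq β₂ q.2 (m n) (hm n)]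
    congr 1
    · simp only [X]; ring
    · simp only [Y, hr]; field_simp
  have e : (n:ℝ) ^ (-(β₁ * (α - 1))) = ((n:ℝ) ^ (-β₁)) ^ α / (n:ℝ) ^ (-β₁) := by
    rw [← Real.rpow_mul hn0.le, ← Real.rpow_sub hn0]
    congr 1; ring
  have u0 : 0 < ((n:ℝ) ^ (-β₁)) ^ α := by positivity
  rw [hρ', e]
  simp only [hr]
  field_simp
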